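/- Fix a sample size n ≥ 2, a bag size m with 1 ≤ m ≤ n, and ε > 0. Let A be any learning algorithm mapping data sets to functions X → Δ_{L−1}, and let Ã_m be its derandomized subbagged version: Ã_m(D)(x) is the average, over all m-element subsets r of the index set of D, of A(D^r)(x), where D^r is the corresponding subsampled data set. Then Ã_m has tail stability (ε, δ) at sample size n for δ = ε^{−2} · ((1 − 1/L)/(n − 1)) · (p/(1 − p)) with p = m/n < 1: for every data set D of size n and every x ∈ X, (1/n)·Σ_{i=1}^n 1{ ‖Ã_m(D)(x) − Ã_m(D^{\i})(x)‖ ≥ ε } ≤ δ, where for the leave-one-out data set D^{\i} (of size n − 1) the average defining Ã_m is taken over all m-element subsets of its n − 1 indices. -/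

import Mathlib

open scoped Classical

noncomputable section

/-- The derandomized subbagged version `Ã_m` of a base learning algorithm `A`:
on a data set `D` of size `k`, `Ã_m(D)(x)` is the average, over all `m`-element
subsets `r` of the index set `Fin k`, of `A(D^r)(x)`, where `D^r` is the subsampled
data set (the points of `D` indexed by `r`, in increasing order of index). -/
def subbag {X : Type*} {L : ℕ}
    (A : ∀ k : ℕ, (Fin k → X × Fin L) → X → EuclideanSpace ℝ (Fin L))
    (m : ℕ) (k : ℕ) (D : Fin k → X × Fin L) (x : X) : EuclideanSpace ℝ (Fin L) :=
  ((k.choose m : ℝ))⁻¹ •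
    ∑ r ∈ (Finset.powersetCard m (Finset.univ : Finset (Fin k))).attach,
      A m (fun i => D ((r.1.orderIsoOfFin (Finset.mem_powersetCard.mp r.2).2 i).1)) x

theorem aux_count (N m : ℕ) (i j : Fin N) :
    (((Finset.powersetCard m (Finset.univ : Finset (Fin N))).filter
      (fun r => i ∉ r ∧ j ∉ r)).card) = (N - ({i, j} : Finset (Fin N)).card).choose m := by
  have : (Finset.powersetCard m (Finset.univ : Finset (Fin N))).filter
      (fun r => i ∉ r ∧ j ∉ r) = Finset.powersetCard m ({i, j} : Finset (Fin N))ᶜ := by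
    ext r
    simp only [Finset.mem_filter, Finset.mem_powersetCard, Finset.subset_univ, true_and,
      Finset.subset_compl_comm (s := r), Finset.insert_subset_iff, Finset.singleton_subset_iff,
      Finset.mem_compl]
    tauto
  rw [this, Finset.card_powersetCard, Finset.card_compl, Fintype.card_fin]

theorem aux_op {E : Type*} [NormedAddCommGroup E] [InnerProductSpace ℝ E]
    (n m : ℕ) (hn : 1 ≤ n) (hm : 1 ≤ m) (hmn : m ≤ n)
    (g : Finset (Fin (n + 1)) → E)
    (hg : ∑ r ∈ Finset.powersetCard m Finset.univ, g r = 0) :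
    ∑ i : Fin (n + 1), ‖∑ r ∈ Finset.powersetCard m Finset.univ,
        (if i ∉ r then (1 : ℝ) else 0) • g r‖ ^ 2
      ≤ ((n - 1).choose (m - 1) : ℝ) * ∑ r ∈ Finset.powersetCard m Finset.univ, ‖g r‖ ^ 2 := by
  set P := Finset.powersetCard m (Finset.univ : Finset (Fin (n + 1))) with hP
  set v : Fin (n + 1) → E := fun i => ∑ r ∈ P, (if i ∉ r then (1 : ℝ) else 0) • g r with hv
  set h : Finset (Fin (n + 1)) → E := fun r => ∑ i, (if i ∉ r then (1 : ℝ) else 0) • v i with hh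
  set lam : ℝ := ((n - 1).choose (m - 1) : ℝ) with hlam
  have hlpos : 0 < lam := by
    have : 0 < (n - 1).choose (m - 1) := Nat.choose_pos (by omega)
    exact Nat.cast_pos.mpr this
  have hv0 : ∑ i, v i = 0 := by
    simp only [hv]
    rw [Finset.sum_comm]
    have : ∀ r ∈ P, ∑ i, (if i ∉ r then (1 : ℝ) else 0) • g r = ((n + 1 - m : ℕ) : ℝ) • g r := by
      intro r hr
      rw [← Finset.sum_smul]
      congr 1
      rw [Finset.sum_boole]
      have hc : (Finset.univ.filter (fun i => i ∉ r)) = rᶜ := by ext; simp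
      rw [hc, Finset.card_compl, Fintype.card_fin, (Finset.mem_powersetCard.mp hr).2]
    rw [Finset.sum_congr rfl this, ← Finset.smul_sum, hg, smul_zero]
  have hS : ∑ i, ‖v i‖ ^ 2 = ∑ r ∈ P, inner ℝ (h r) (g r) := by
    have h1 : ∀ i, ‖v i‖ ^ 2 = ∑ r ∈ P, (if i ∉ r then (1 : ℝ) else 0) * inner ℝ (v i) (g r) := by
      intro i
      rw [← real_inner_self_eq_norm_sq]
      conv_lhs => rw [show inner ℝ (v i) (v i) = inner ℝ (v i)
        (∑ r ∈ P, (if i ∉ r then (1 : ℝ) else 0) • g r) from rfl]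
      rw [inner_sum]
      simp only [real_inner_smul_right]
    simp only [h1, hh, sum_inner, real_inner_smul_left]
    rw [Finset.sum_comm]
  have hH : ∑ r ∈ P, ‖h r‖ ^ 2 = lam * ∑ i, ‖v i‖ ^ 2 := by
    have h1 : ∀ r, ‖h r‖ ^ 2 = ∑ i, ∑ j, (if i ∉ r ∧ j ∉ r then (1 : ℝ) else 0)
        * inner ℝ (v i) (v j) := by
      intro r
      rw [← real_inner_self_eq_norm_sq]
      simp only [hh, sum_inner, inner_sum, real_inner_smul_left, real_inner_smul_right]
      refine Finset.sum_congr rfl fun i _ => Finset.sum_congr rfl fun j _ => ?_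
      by_cases hi : i ∈ r <;> by_cases hj : j ∈ r <;> simp [hi, hj, real_inner_comm]
    have h2 : ∀ i j, ∑ r ∈ P, (if i ∉ r ∧ j ∉ r then (1 : ℝ) else 0)
        = ((n - 1).choose m : ℝ) + if i = j then lam else 0 := by
      intro i j
      rw [Finset.sum_boole, hP, aux_count]
      by_cases hij : i = j
      · subst hij
        obtain ⟨n, rfl⟩ : ∃ k, n = k + 1 := ⟨n - 1, by omega⟩
        obtain ⟨m, rfl⟩ : ∃ k, m = k + 1 := ⟨m - 1, by omega⟩
        simp [hlam, Nat.choose_succ_succ]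
        ring
      · rw [Finset.card_pair hij]
        simp [hij]
    simp only [h1]
    rw [Finset.sum_comm]
    have h3 : ∀ i, ∑ r ∈ P, ∑ j, (if i ∉ r ∧ j ∉ r then (1 : ℝ) else 0) * inner ℝ (v i) (v j)
        = lam * ‖v i‖ ^ 2 := by
      intro i
      rw [Finset.sum_comm]
      simp only [← Finset.sum_mul, h2]
      simp only [add_mul, Finset.sum_add_distrib, ← Finset.mul_sum,
        ← inner_sum, hv0, inner_zero_right, mul_zero, zero_add, ite_mul, zero_mul,
        Finset.sum_ite_eq, Finset.mem_univ, if_true, real_inner_self_eq_norm_sq]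
    simp only [h3, Finset.mul_sum]
  have hmain : 0 ≤ ∑ r ∈ P, ‖h r - lam • g r‖ ^ 2 := Finset.sum_nonneg fun _ _ => sq_nonneg _
  have hexp : ∑ r ∈ P, ‖h r - lam • g r‖ ^ 2
      = ∑ r ∈ P, ‖h r‖ ^ 2 - 2 * lam * ∑ r ∈ P, inner ℝ (h r) (g r)
        + lam ^ 2 * ∑ r ∈ P, ‖g r‖ ^ 2 := by
    rw [Finset.mul_sum, Finset.mul_sum, ← Finset.sum_sub_distrib, ← Finset.sum_add_distrib]
    refine Finset.sum_congr rfl fun r _ => ?_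
    rw [norm_sub_sq_real, real_inner_smul_right, norm_smul, mul_pow, Real.norm_eq_abs, sq_abs]
    ring
  rw [hexp, hH, ← hS] at hmain
  have : 0 ≤ lam * (lam * ∑ r ∈ P, ‖g r‖ ^ 2 - ∑ i, ‖v i‖ ^ 2) := by linarith
  have := nonneg_of_mul_nonneg_right this hlpos
  linarith

/-- extension of the base algorithm's predictions to all index sets -/
def auxF {X : Type*} {L : ℕ}
    (A : ∀ k : ℕ, (Fin k → X × Fin L) → X → EuclideanSpace ℝ (Fin L))
    (m : ℕ) (k : ℕ) (D : Fin k → X × Fin L) (x : X) (r : Finset (Fin k)) :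
    EuclideanSpace ℝ (Fin L) :=
  if h : r.card = m then A m (fun i => D (r.orderEmbOfFin h i)) x else 0

theorem subbag_eq {X : Type*} {L : ℕ}
    (A : ∀ k : ℕ, (Fin k → X × Fin L) → X → EuclideanSpace ℝ (Fin L))
    (m : ℕ) (k : ℕ) (D : Fin k → X × Fin L) (x : X) :
    subbag A m k D x = ((k.choose m : ℝ))⁻¹ •
      ∑ r ∈ Finset.powersetCard m (Finset.univ : Finset (Fin k)), auxF A m k D x r := by
  unfold subbag
  congr 1
  rw [← Finset.sum_attach (Finset.powersetCard m (Finset.univ : Finset (Fin k)))]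
  refine Finset.sum_congr rfl fun r _ => ?_
  rw [auxF, dif_pos (Finset.mem_powersetCard.mp r.2).2]
  rfl

theorem auxF_map {X : Type*} {L : ℕ}
    (A : ∀ k : ℕ, (Fin k → X × Fin L) → X → EuclideanSpace ℝ (Fin L))
    (m n : ℕ) (D : Fin (n + 1) → X × Fin L) (x : X) (i : Fin (n + 1)) (r : Finset (Fin n)) :
    auxF A m n (fun t => D (i.succAbove t)) x r
      = auxF A m (n + 1) D x (r.map i.succAboveEmb) := by
  unfold auxF
  by_cases h : r.card = m
  · have h' : (r.map i.succAboveEmb).card = m := by rw [Finset.card_map, h]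
    rw [dif_pos h, dif_pos h']
    have := Finset.orderEmbOfFin_unique h' (f := fun t => i.succAbove (r.orderEmbOfFin h t))
      (fun t => by
        simp only [Finset.mem_map]
        exact ⟨_, Finset.orderEmbOfFin_mem r h t, rfl⟩)
      ((Fin.strictMono_succAbove i).comp (r.orderEmbOfFin h).strictMono)
    congr 1
    funext t
    rw [← this]
  · have h' : ¬ (r.map i.succAboveEmb).card = m := by rwa [Finset.card_map]
    rw [dif_neg h, dif_neg h']

theorem subbag_loo {X : Type*} {L : ℕ}
    (A : ∀ k : ℕ, (Fin k → X × Fin L) → X → EuclideanSpace ℝ (Fin L))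
    (m n : ℕ) (D : Fin (n + 1) → X × Fin L) (x : X) (i : Fin (n + 1)) :
    subbag A m n (fun t => D (i.succAbove t)) x = ((n.choose m : ℝ))⁻¹ •
      ∑ r ∈ Finset.powersetCard m (Finset.univ : Finset (Fin (n + 1))),
        (if i ∉ r then (1 : ℝ) else 0) • auxF A m (n + 1) D x r := by
  rw [subbag_eq]
  congr 1
  simp only [auxF_map, ite_smul, one_smul, zero_smul]
  rw [← Finset.sum_filter]
  have : (Finset.powersetCard m (Finset.univ : Finset (Fin (n + 1)))).filter (fun r => i ∉ r)
      = (Finset.powersetCard m (Finset.univ : Finset (Fin n))).map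
        (Finset.mapEmbedding i.succAboveEmb).toEmbedding := by
    rw [← Finset.powersetCard_map]
    ext r
    simp only [Finset.mem_filter, Finset.mem_powersetCard, Finset.subset_univ, true_and]
    have : (Finset.univ : Finset (Fin n)).map i.succAboveEmb = {i}ᶜ := by
      ext t; simp [Fin.exists_succAbove_eq_iff]
    rw [this, Finset.subset_compl_comm, Finset.singleton_subset_iff, Finset.mem_compl]
    tauto
  rw [this, Finset.sum_map]
  rfl

theorem simplex_norm_le {L : ℕ} (w : EuclideanSpace ℝ (Fin L))
    (h0 : ∀ i, 0 ≤ w i) (h1 : ∑ i, w i = 1) : ‖w‖ ^ 2 ≤ 1 := by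
  rw [EuclideanSpace.real_norm_sq_eq, ← h1]
  refine Finset.sum_le_sum fun i _ => ?_
  have : w i ≤ 1 := by
    rw [← h1]; exact Finset.single_le_sum (fun j _ => h0 j) (Finset.mem_univ i)
  nlinarith [h0 i]

theorem simplex_le_norm {L : ℕ} (hL : 2 ≤ L) (w : EuclideanSpace ℝ (Fin L))
    (h1 : ∑ i, w i = 1) : 1 / (L : ℝ) ≤ ‖w‖ ^ 2 := by
  rw [EuclideanSpace.real_norm_sq_eq]
  have := sq_sum_le_card_mul_sum_sq (s := (Finset.univ : Finset (Fin L))) (f := fun i => w i)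
  rw [h1, Finset.card_univ, Fintype.card_fin] at this
  have hLp : (0 : ℝ) < L := by exact_mod_cast (by omega : 0 < L)
  rw [div_le_iff₀ hLp]
  linarith

/-- Tail stability of subbagging: for sample size `n + 1 ≥ 2`, bag size `1 ≤ m ≤ n`,
and any base learning algorithm `A` with outputs in the probability simplex `Δ_{L−1}`,
the subbagged algorithm `Ã_m` has tail stability `(ε, δ)` at sample size `n + 1`, with
`δ = ε⁻² · ((1 − 1/L)/((n+1) − 1)) · (p/(1 − p))`, `p = m/(n+1)`.  Here
`fun t => D (i.succAbove t)` is the leave-one-out data set `D^{\i}` of size `n`. -/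
theorem subbagging_tail_stability
    (X : Type*) (L : ℕ) (hL : 2 ≤ L) (n : ℕ) (hn : 1 ≤ n)
    (m : ℕ) (hm : 1 ≤ m) (hmn : m ≤ n) (ε : ℝ) (hε : 0 < ε)
    (A : ∀ k : ℕ, (Fin k → X × Fin L) → X → EuclideanSpace ℝ (Fin L))
    (hA : ∀ k D x, (∀ i, 0 ≤ A k D x i) ∧ ∑ i, A k D x i = 1)
    (D : Fin (n + 1) → X × Fin L) (x : X) :
    (∑ i : Fin (n + 1),
        if ε ≤ dist (subbag A m (n + 1) D x)
            (subbag A m n (fun t => D (i.succAbove t)) x)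
        then (1 : ℝ) else 0) / (n + 1)
      ≤ (1 / ε ^ 2) * ((1 - 1 / (L : ℝ)) / n)
          * (((m : ℝ) / (n + 1)) / (1 - (m : ℝ) / (n + 1))) := by
  set P := Finset.powersetCard m (Finset.univ : Finset (Fin (n + 1))) with hP
  set F := auxF A m (n + 1) D x with hF
  set μ := subbag A m (n + 1) D x with hμ
  set C : ℝ := ((n + 1).choose m : ℝ) with hC
  set c : ℝ := (n.choose m : ℝ) with hc
  have hCpos : 0 < C := by
    have : 0 < (n + 1).choose m := Nat.choose_pos (by omega)
    exact Nat.cast_pos.mpr this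
  have hcpos : 0 < c := by
    have : 0 < n.choose m := Nat.choose_pos (by omega)
    exact Nat.cast_pos.mpr this
  have hPC : (P.card : ℝ) = C := by
    rw [hP, Finset.card_powersetCard, Finset.card_univ, Fintype.card_fin]
  have hμF : C • μ = ∑ r ∈ P, F r := by
    rw [hμ, subbag_eq, smul_inv_smul₀ hCpos.ne']
  have hFs : ∀ r ∈ P, (∀ i, 0 ≤ F r i) ∧ ∑ i, F r i = 1 := by
    intro r hr
    rw [hF, auxF, dif_pos (Finset.mem_powersetCard.mp hr).2]
    exact hA _ _ _
  have hg0 : ∑ r ∈ P, (F r - μ) = 0 := by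
    rw [Finset.sum_sub_distrib, ← hμF, Finset.sum_const, ← Nat.cast_smul_eq_nsmul ℝ, hPC, sub_self]
  have hμ1 : ∑ i, μ i = 1 := by
    have h1 : ∀ i, C * μ i = ∑ r ∈ P, F r i := by
      intro i
      have := congrArg (fun w : EuclideanSpace ℝ (Fin L) => w i) hμF
      simpa using this
    have h2 : C * ∑ i, μ i = C := by
      rw [Finset.mul_sum]
      simp only [h1]
      rw [Finset.sum_comm, Finset.sum_congr rfl fun r hr => (hFs r hr).2]
      simp [hPC]
    exact mul_left_cancel₀ hCpos.ne' (by rw [h2, mul_one])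
  have hvar : ∑ r ∈ P, ‖F r - μ‖ ^ 2 ≤ C * (1 - 1 / (L : ℝ)) := by
    have h1 : ∑ r ∈ P, ‖F r - μ‖ ^ 2 = ∑ r ∈ P, ‖F r‖ ^ 2 - C * ‖μ‖ ^ 2 := by
      simp only [norm_sub_sq_real]
      rw [Finset.sum_add_distrib, Finset.sum_sub_distrib, ← Finset.mul_sum, ← sum_inner, ← hμF,
        real_inner_smul_left, real_inner_self_eq_norm_sq, Finset.sum_const, nsmul_eq_mul, hPC]
      ring
    have h2 : ∑ r ∈ P, ‖F r‖ ^ 2 ≤ C := by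
      calc _ ≤ ∑ r ∈ P, (1 : ℝ) :=
            Finset.sum_le_sum fun r hr => simplex_norm_le _ (hFs r hr).1 (hFs r hr).2
        _ = C := by simp [hPC]
    have h3 := mul_le_mul_of_nonneg_left (simplex_le_norm hL μ hμ1) hCpos.le
    rw [h1]; linarith
  have hcnt : ∀ i : Fin (n + 1), ∑ r ∈ P, (if i ∉ r then (1 : ℝ) else 0) = c := by
    intro i
    have := aux_count (n + 1) m i i
    simp only [and_self, Finset.pair_eq_singleton, Finset.card_singleton,
      Nat.add_sub_cancel] at this
    rw [Finset.sum_boole, hP, this]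
  have hd : ∀ i : Fin (n + 1), c ^ 2 * dist μ (subbag A m n (fun t => D (i.succAbove t)) x) ^ 2
      = ‖∑ r ∈ P, (if i ∉ r then (1 : ℝ) else 0) • (F r - μ)‖ ^ 2 := by
    intro i
    simp only [smul_sub, Finset.sum_sub_distrib, ← Finset.sum_smul, hcnt]
    have h1 : ∑ r ∈ P, (if i ∉ r then (1 : ℝ) else 0) • F r
        = c • subbag A m n (fun t => D (i.succAbove t)) x := by
      rw [subbag_loo, smul_inv_smul₀ hcpos.ne']
    rw [h1, ← smul_sub, norm_smul, mul_pow, Real.norm_eq_abs, sq_abs, dist_comm, dist_eq_norm]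
  have hop := aux_op n m hn hm hmn (fun r => F r - μ) hg0
  rw [← hP] at hop
  simp only [← hd, ← Finset.mul_sum] at hop
  set lam : ℝ := ((n - 1).choose (m - 1) : ℝ) with hlam
  set T := ∑ i : Fin (n + 1), dist μ (subbag A m n (fun t => D (i.succAbove t)) x) ^ 2 with hT
  have hl0 : 0 ≤ lam := Nat.cast_nonneg _
  have hT1 : c ^ 2 * T ≤ lam * (C * (1 - 1 / (L : ℝ))) :=
    hop.trans (mul_le_mul_of_nonneg_left hvar hl0)
  have e1 : lam * n = c * m := by
    obtain ⟨k, rfl⟩ : ∃ k, n = k + 1 := ⟨n - 1, by omega⟩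
    obtain ⟨l, rfl⟩ : ∃ k, m = k + 1 := ⟨m - 1, by omega⟩
    have := Nat.add_one_mul_choose_eq k l
    rw [hlam, hc, mul_comm]
    exact_mod_cast this
  have e2 : c * (n + 1) = C * (n + 1 - m) := by
    have := Nat.choose_mul_succ_eq n m
    have h2 : ((n + 1 - m : ℕ) : ℝ) = (n : ℝ) + 1 - m := by
      rw [Nat.cast_sub (by omega)]; push_cast; ring
    rw [hc, hC, ← h2]
    exact_mod_cast this
  have hnp : (0 : ℝ) < n := by exact_mod_cast hn
  have hqp : (0 : ℝ) < (n : ℝ) + 1 - m := by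
    have : (m : ℝ) ≤ n := by exact_mod_cast hmn
    linarith
  have hind : ε ^ 2 * (∑ i : Fin (n + 1),
        if ε ≤ dist μ (subbag A m n (fun t => D (i.succAbove t)) x) then (1 : ℝ) else 0) ≤ T := by
    rw [Finset.mul_sum]
    refine Finset.sum_le_sum fun i _ => ?_
    split_ifs with h
    · rw [mul_one]; gcongr
    · rw [mul_zero]; positivity
  have hT2 : T ≤ (1 - 1 / (L : ℝ)) * (m * (n + 1) / (n * (n + 1 - m))) := by
    have e : lam * (C * (1 - 1 / (L : ℝ)))
        = c ^ 2 * ((1 - 1 / (L : ℝ)) * (m * (n + 1) / (n * (n + 1 - m)))) := by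
      have hl : lam = c * m / n := by rw [eq_div_iff hnp.ne', e1]
      have hC' : C = c * (n + 1) / (n + 1 - m) := by rw [eq_div_iff hqp.ne', e2]
      rw [hl, hC']
      field_simp
    rw [e] at hT1
    exact le_of_mul_le_mul_left hT1 (by positivity)
  have hrhs : (1 / ε ^ 2) * ((1 - 1 / (L : ℝ)) / n)
          * (((m : ℝ) / (n + 1)) / (1 - (m : ℝ) / (n + 1)))
      = ((1 - 1 / (L : ℝ)) * (m * (n + 1) / (n * (n + 1 - m)))) / (ε ^ 2 * (n + 1)) := by
    have hq : (1 - (m : ℝ) / (n + 1)) = (n + 1 - m) / (n + 1) := by field_simp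
    rw [hq]
    generalize (1 - 1 / (L : ℝ)) = a
    field_simp
  rw [hrhs, div_le_div_iff₀ (by positivity) (by positivity)]
  have := mul_le_mul_of_nonneg_right (hind.trans hT2) (by positivity : (0 : ℝ) ≤ n + 1)
  linarith
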